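/- arXiv:1903.03242 — 2 statements merged into one kernel-verified Lean document; each statement's English description precedes it below -/
import Mathlib

section
/- Extremal location–scale representation of the conditional quantile (equation (2) of the paper): let γ > 0, H > 0, f ∈ ℝ, let L : (0,∞) → (0,∞) be slowly varying, and let F, F_Y : ℝ → [0,1] be continuous, strictly increasing distribution functions with F(z) < 1 and F_Y(z) < 1 for all z. Assume (1 − F(z))·z^{1/γ}/L(z) → 1 as z → ∞, and (1 − F_Y(y + f)) / (H·(1 − F(y))) → 1 as y → ∞. Define the quantile functions q(τ) = inf{t : F(t) ≥ τ} and q_Y(τ) = inf{t : F_Y(t) ≥ τ}. Then (q_Y(τ) − f) / q(τ) → H^γ as τ → 1⁻; that is, q_Y(τ) = f + h·q(τ)(1 + o(1)) with h = H^γ. -/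
open Filter Topology Set

/-- The quantile function of a continuous, strictly increasing distribution function is a
right inverse of it on `(0, 1)`. -/
theorem apply_sInf_setOf_le_eq {F : ℝ → ℝ} (hcont : Continuous F) (hmono : StrictMono F)
    (htop : Tendsto F atTop (𝓝 1)) (hbot : Tendsto F atBot (𝓝 0))
    {τ : ℝ} (h0 : 0 < τ) (h1 : τ < 1) : F (sInf {t : ℝ | τ ≤ F t}) = τ := by
  obtain ⟨a, ha⟩ := (hbot.eventually (gt_mem_nhds h0)).exists
  obtain ⟨b, hb⟩ := (htop.eventually (lt_mem_nhds h1)).exists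
  obtain ⟨z, rfl⟩ := mem_range_of_exists_le_of_exists_ge hcont ⟨a, ha.le⟩ ⟨b, hb.le⟩
  have : {t : ℝ | F z ≤ F t} = Ici z := by
    ext t
    simp [hmono.le_iff_le]
  rw [this, csInf_Ici]

/-- A function asymptotic to `z ^ (-a) * L z` with `L` slowly varying is regularly varying
with index `-a`. -/
theorem tendsto_comp_mul_div_of_slowlyVarying {G L : ℝ → ℝ} {a : ℝ}
    (hLpos : ∀ t, 0 < t → 0 < L t)
    (hLslow : ∀ m : ℝ, 0 < m → Tendsto (fun t => L (m * t) / L t) atTop (𝓝 1))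
    (hG : ∀ z, 0 < G z) (hTail : Tendsto (fun z => G z * z ^ a / L z) atTop (𝓝 1))
    {c : ℝ} (hc : 0 < c) :
    Tendsto (fun t => G (c * t) / G t) atTop (𝓝 (c ^ (-a))) := by
  have hscaled := hTail.comp (tendsto_id.const_mul_atTop hc)
  have h := ((hscaled.div hTail one_ne_zero).mul (hLslow c hc)).mul_const (c ^ (-a))
  simp only [div_one, one_mul] at h
  refine h.congr' ?_
  filter_upwards [eventually_gt_atTop 0] with t ht
  have h1 := (hLpos t ht).ne'
  have h2 := (hLpos (c * t) (mul_pos hc ht)).ne'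
  have h3 := (hG t).ne'
  have h4 := (Real.rpow_pos_of_pos ht a).ne'
  have h5 := (Real.rpow_pos_of_pos hc a).ne'
  simp only [Function.comp_apply, id_eq, Pi.div_apply]
  rw [Real.mul_rpow hc.le ht.le, Real.rpow_neg hc.le]
  field_simp

/-- Extremal location–scale representation of the conditional quantile: if `F` has a
Pareto-type tail with index `γ > 0` and slowly varying factor `L`, and
`(1 − F_Y(y + f)) / (H (1 − F(y))) → 1` as `y → ∞`, then the quantile functions
satisfy `(q_Y(τ) − f)/q(τ) → H^γ` as `τ → 1⁻`. -/
theorem extremal_location_scale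
    (γ H f : ℝ) (hγ : 0 < γ) (hH : 0 < H)
    (L : ℝ → ℝ) (hLpos : ∀ t, 0 < t → 0 < L t)
    (hLslow : ∀ m : ℝ, 0 < m → Tendsto (fun t => L (m * t) / L t) atTop (nhds 1))
    (F FY : ℝ → ℝ)
    (hFcont : Continuous F) (hFmono : StrictMono F)
    (hF01 : ∀ z, 0 ≤ F z ∧ F z < 1)
    (hFtop : Tendsto F atTop (nhds 1)) (hFbot : Tendsto F atBot (nhds 0))
    (hFYcont : Continuous FY) (hFYmono : StrictMono FY)
    (hFY01 : ∀ z, 0 ≤ FY z ∧ FY z < 1)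
    (hFYtop : Tendsto FY atTop (nhds 1)) (hFYbot : Tendsto FY atBot (nhds 0))
    (hTail : Tendsto (fun z => (1 - F z) * z ^ (1 / γ) / L z) atTop (nhds 1))
    (hEquiv : Tendsto (fun y => (1 - FY (y + f)) / (H * (1 - F y))) atTop (nhds 1))
    (q qY : ℝ → ℝ)
    (hq : ∀ τ, q τ = sInf {t : ℝ | τ ≤ F t})
    (hqY : ∀ τ, qY τ = sInf {t : ℝ | τ ≤ FY t}) :
    Tendsto (fun τ => (qY τ - f) / q τ) (nhdsWithin 1 (Set.Iio 1)) (nhds (H ^ γ)) := by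
  have hqval : ∀ τ, 0 < τ → τ < 1 → F (q τ) = τ := fun τ h0 h1 => by
    rw [hq]; exact apply_sInf_setOf_le_eq hFcont hFmono hFtop hFbot h0 h1
  have hqYval : ∀ τ, 0 < τ → τ < 1 → FY (qY τ) = τ := fun τ h0 h1 => by
    rw [hqY]; exact apply_sInf_setOf_le_eq hFYcont hFYmono hFYtop hFYbot h0 h1
  have hunit : ∀ᶠ τ : ℝ in 𝓝[<] 1, 0 < τ ∧ τ < 1 := Ioo_mem_nhdsLT one_pos
  have hqtop : Tendsto q (𝓝[<] 1) atTop := by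
    refine tendsto_atTop.2 fun b => ?_
    filter_upwards [hunit, nhdsWithin_le_nhds (lt_mem_nhds (hF01 b).2)] with τ hτ hb
    rw [← hqval τ hτ.1 hτ.2] at hb
    exact (hFmono.lt_iff_lt.1 hb).le
  have hG : ∀ z, 0 < 1 - F z := fun z => sub_pos.2 (hF01 z).2
  have hratio : ∀ c : ℝ, 0 < c →
      Tendsto (fun τ => (1 - FY (c * q τ + f)) / (1 - τ)) (𝓝[<] 1)
        (𝓝 (H * c ^ (-(1 / γ)))) := by
    intro c hc
    have h1 := (hEquiv.comp (tendsto_id.const_mul_atTop hc)).comp hqtop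
    have h2 := (tendsto_comp_mul_div_of_slowlyVarying hLpos hLslow hG hTail hc).comp hqtop
    have h := h1.mul (h2.const_mul H)
    rw [one_mul] at h
    refine h.congr' ?_
    filter_upwards [hunit] with τ hτ
    have h3 := (hG (c * q τ)).ne'
    have h4 := (sub_pos.2 hτ.2).ne'
    simp only [Function.comp_apply, id_eq, hqval τ hτ.1 hτ.2]
    field_simp
  have hpow : H = (H ^ γ) ^ (1 / γ) := by
    rw [← Real.rpow_mul hH.le, mul_one_div_cancel hγ.ne', Real.rpow_one]
  have hHγ : 0 < H ^ γ := Real.rpow_pos_of_pos hH γ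
  have hinv : 0 < 1 / γ := one_div_pos.2 hγ
  refine tendsto_order.2 ⟨fun b hb => ?_, fun b hb => ?_⟩
  · obtain ⟨c, hbc, hcH⟩ := exists_between (max_lt hb hHγ)
    have hc : 0 < c := (le_max_right _ _).trans_lt hbc
    have hlim : 1 < H * c ^ (-(1 / γ)) := by
      rw [Real.rpow_neg hc.le, ← div_eq_mul_inv, one_lt_div (Real.rpow_pos_of_pos hc _)]
      exact (Real.rpow_lt_rpow hc.le hcH hinv).trans_eq hpow.symm
    filter_upwards [hunit, hqtop.eventually_gt_atTop 0,
      (hratio c hc).eventually (lt_mem_nhds hlim)] with τ hτ hqpos hτlim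
    rw [one_lt_div (sub_pos.2 hτ.2), sub_lt_sub_iff_left] at hτlim
    have hlt : c * q τ + f < qY τ :=
      hFYmono.lt_iff_lt.1 (hτlim.trans_eq (hqYval τ hτ.1 hτ.2).symm)
    exact ((le_max_left _ _).trans_lt hbc).trans ((lt_div_iff₀ hqpos).2 (by linarith))
  · obtain ⟨c, hHc, hcb⟩ := exists_between hb
    have hc : 0 < c := hHγ.trans hHc
    have hlim : H * c ^ (-(1 / γ)) < 1 := by
      rw [Real.rpow_neg hc.le, ← div_eq_mul_inv, div_lt_one (Real.rpow_pos_of_pos hc _)]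
      exact hpow.trans_lt (Real.rpow_lt_rpow hHγ.le hHc hinv)
    filter_upwards [hunit, hqtop.eventually_gt_atTop 0,
      (hratio c hc).eventually (gt_mem_nhds hlim)] with τ hτ hqpos hτlim
    rw [div_lt_one (sub_pos.2 hτ.2), sub_lt_sub_iff_left] at hτlim
    have hlt : qY τ < c * q τ + f :=
      hFYmono.lt_iff_lt.1 ((hqYval τ hτ.1 hτ.2).trans_lt hτlim)
    exact ((div_lt_iff₀ hqpos).2 (by linarith)).trans hcb
end

section
/- Conditional density asymptotics at the extremal quantile: let γ > 0, H > 0, let L : (0,∞) → (0,∞) be slowly varying, and let q : (0,1) → ℝ be differentiable on a neighborhood (τ₀, 1) of 1 with q(τ)·(1 − τ)^γ / L(1/(1 − τ)) → 1 and q′(τ) / (γ(1 − τ)^{−γ−1} L(1/(1 − τ))) → 1 as τ → 1⁻. Let q_V be differentiable on (τ₁, 1) for some τ₁ ∈ (0,1) with 1 − (1 − τ)/H ∈ (τ₀, 1) for τ ∈ (τ₁, 1), and assume q_V′(τ) / (H^{−1}·q′(1 − (1 − τ)/H)) → 1 as τ → 1⁻. Then q(τ) / ((1 − τ)·q_V′(τ))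 → γ^{−1} H^{−γ} as τ → 1⁻. Equivalently, writing f_V(q_V(τ)) = 1/q_V′(τ) for the density at the quantile, one has q(τ)·f_V(q_V(τ))/(1 − τ) → γ^{−1} H^{−γ}. -/
open Filter Topology Set

/-- Conditional density asymptotics at the extremal quantile: under the Pareto-type
quantile conditions on `q` (with index `γ > 0` and slowly varying `L`) and the
condition `q_V′(τ)/(H⁻¹ q′(1 − (1 − τ)/H)) → 1` (condition A4), one has
`q(τ)/((1 − τ) q_V′(τ)) → γ⁻¹ H^{−γ}` as `τ → 1⁻`. -/
theorem conditional_density_asymptotics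
    (γ H : ℝ) (hγ : 0 < γ) (hH : 0 < H)
    (L : ℝ → ℝ) (hLpos : ∀ t, 0 < t → 0 < L t)
    (hLslow : ∀ m : ℝ, 0 < m → Tendsto (fun t => L (m * t) / L t) atTop (nhds 1))
    (q qV : ℝ → ℝ) (τ₀ τ₁ : ℝ)
    (hτ₀ : τ₀ ∈ Set.Ioo (0:ℝ) 1) (hτ₁ : τ₁ ∈ Set.Ioo (0:ℝ) 1)
    (hqdiff : ∀ τ ∈ Set.Ioo τ₀ 1, DifferentiableAt ℝ q τ)
    (hq1 : Tendsto (fun τ => q τ * (1 - τ) ^ γ / L (1 / (1 - τ)))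
      (nhdsWithin 1 (Set.Iio 1)) (nhds 1))
    (hq2 : Tendsto (fun τ => deriv q τ / (γ * (1 - τ) ^ (-γ - 1) * L (1 / (1 - τ))))
      (nhdsWithin 1 (Set.Iio 1)) (nhds 1))
    (hqVdiff : ∀ τ ∈ Set.Ioo τ₁ 1, DifferentiableAt ℝ qV τ)
    (hmap : ∀ τ ∈ Set.Ioo τ₁ 1, 1 - (1 - τ) / H ∈ Set.Ioo τ₀ 1)
    (hA4 : Tendsto (fun τ => deriv qV τ / (H⁻¹ * deriv q (1 - (1 - τ) / H)))
      (nhdsWithin 1 (Set.Iio 1)) (nhds 1)) :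
    Tendsto (fun τ => q τ / ((1 - τ) * deriv qV τ))
      (nhdsWithin 1 (Set.Iio 1)) (nhds (γ⁻¹ * H ^ (-γ))) := by
  have hsub : Tendsto (fun τ : ℝ => 1 - (1 - τ) / H) (𝓝[<] 1) (𝓝[<] 1) := by
    refine tendsto_nhdsWithin_iff.2 ⟨?_, ?_⟩
    · have hc : Continuous fun τ : ℝ => 1 - (1 - τ) / H := by fun_prop
      simpa using (hc.tendsto 1).mono_left nhdsWithin_le_nhds
    · filter_upwards [self_mem_nhdsWithin] with τ hτ
      have : 0 < (1 - τ) / H := div_pos (sub_pos.2 hτ) hH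
      simpa using this
  have hinv : Tendsto (fun τ : ℝ => (1 - τ)⁻¹) (𝓝[<] 1) atTop := by
    refine tendsto_inv_nhdsGT_zero.comp (tendsto_nhdsWithin_iff.2 ⟨?_, ?_⟩)
    · have hc : Continuous fun τ : ℝ => 1 - τ := by fun_prop
      simpa using (hc.tendsto 1).mono_left nhdsWithin_le_nhds
    · filter_upwards [self_mem_nhdsWithin] with τ hτ using sub_pos.2 (mem_Iio.1 hτ)
  have hR := (hLslow H hH).comp hinv
  have hB := hq2.comp hsub
  have hlim := ((((hq1.div hB one_ne_zero).div hA4 one_ne_zero).div hR one_ne_zero).mul_const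
    (γ⁻¹ * H ^ (-γ)))
  simp only [div_one, one_mul] at hlim
  refine hlim.congr' ?_
  filter_upwards [self_mem_nhdsWithin, hB.eventually_ne one_ne_zero,
    hA4.eventually_ne one_ne_zero] with τ hτ hBτ hCτ
  have hs : 0 < 1 - τ := sub_pos.2 hτ
  simp only [Function.comp_apply, Pi.div_apply, sub_sub_cancel] at hBτ ⊢
  have hd : deriv q (1 - (1 - τ) / H) ≠ 0 := fun h => hBτ (by simp [h])
  have hv : deriv qV τ ≠ 0 := fun h => hCτ (by simp [h])
  have hL1 : L (1 - τ)⁻¹ ≠ 0 := (hLpos _ (inv_pos.2 hs)).ne'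
  have hL2 : L (H * (1 - τ)⁻¹) ≠ 0 := (hLpos _ (mul_pos hH (inv_pos.2 hs))).ne'
  have e : 1 / ((1 - τ) / H) = H * (1 - τ)⁻¹ := by rw [one_div_div, div_eq_mul_inv]
  have epow : ((1 - τ) / H) ^ (-γ - 1) = H ^ γ * H / ((1 - τ) ^ γ * (1 - τ)) := by
    rw [← neg_add', Real.rpow_neg (div_pos hs hH).le, Real.div_rpow hs.le hH.le, inv_div,
      Real.rpow_add_one hH.ne', Real.rpow_add_one hs.ne']
  have hx : (1 - τ) ^ γ ≠ 0 := (Real.rpow_pos_of_pos hs γ).ne'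
  have hh : H ^ γ ≠ 0 := (Real.rpow_pos_of_pos hH γ).ne'
  rw [e, epow, one_div, Real.rpow_neg hH.le]
  have hs' := hs.ne'
  generalize L (1 - τ)⁻¹ = l₁ at *
  generalize L (H * (1 - τ)⁻¹) = l₂ at *
  generalize (1 - τ) ^ γ = x at *
  generalize H ^ γ = h at *
  generalize deriv q (1 - (1 - τ) / H) = d at *
  generalize deriv qV τ = v at *
  generalize 1 - τ = s at *
  field_simp
end
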